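/- arXiv:2405.13879 — 8 statements merged into one kernel-verified Lean document; each statement's English description precedes it below -/
import Mathlib

section
/- Let γ, σ², L, c be positive real numbers, let M > 0, and define the federated agent loss ℓ_F(m) = γσ²L/(2(m + M)) + c·m for m ≥ 0. If M ≥ √(γσ²L/(2c)), then ℓ_F is minimized on [0, ∞) at m = 0, i.e., ℓ_F(0) ≤ ℓ_F(m) for all m ≥ 0 (total free riding is optimal). -/
/-- If the other agents' total data satisfies `M ≥ √(γσ²L/(2c))`, then the
federated loss `ℓ_F(m) = γσ²L/(2(m + M)) + c·m` is minimized on `[0, ∞)` at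
`m = 0` (total free riding is optimal). -/
theorem total_free_riding_optimal
    (γ σ2 L c M : ℝ) (hγ : 0 < γ) (hσ : 0 < σ2) (hL : 0 < L) (hc : 0 < c)
    (hM : 0 < M)
    (ℓF : ℝ → ℝ) (hℓF : ∀ m, ℓF m = γ * σ2 * L / (2 * (m + M)) + c * m)
    (hMge : Real.sqrt (γ * σ2 * L / (2 * c)) ≤ M) :
    ∀ m : ℝ, 0 ≤ m → ℓF 0 ≤ ℓF m := by
  intro m hm
  have hA : γ * σ2 * L ≤ M ^ 2 * (2 * c) :=
    (div_le_iff₀ (by positivity)).mp ((Real.sqrt_le_left hM.le).mp hMge)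
  have hmM : 0 < m + M := by positivity
  have hdiff : ℓF m - ℓF 0 =
      m * (2 * c * M * m + (M ^ 2 * (2 * c) - γ * σ2 * L)) / (2 * M * (m + M)) := by
    rw [hℓF, hℓF, zero_add]
    field_simp
    ring
  rw [← sub_nonneg, hdiff]
  have := sub_nonneg.mpr hA
  positivity
end

section
/- Let γ, σ², L, c be positive real numbers, let m* = √(γσ²L/(2c)), and suppose the other agents' total data satisfies M ≥ m*. Then the free-riding agent's federated loss with zero data satisfies ℓ_F(0) = γσ²L/(2M) ≤ ℓ_l(m*) = √(2γσ²Lc), i.e., contributing nothing yields loss no worse than the optimal local loss. -/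
/-- If the other agents' total data satisfies `M ≥ m* = √(γσ²L/(2c))`, then the
free-riding agent's federated loss with zero data satisfies
`ℓ_F(0) = γσ²L/(2M) ≤ ℓ_l(m*) = √(2γσ²Lc)`. -/
theorem free_riding_no_worse_than_local
    (γ σ2 L c M : ℝ) (hγ : 0 < γ) (hσ : 0 < σ2) (hL : 0 < L) (hc : 0 < c)
    (mstar : ℝ) (hmstar : mstar = Real.sqrt (γ * σ2 * L / (2 * c)))
    (hM : mstar ≤ M)
    (ℓl : ℝ → ℝ) (hℓl : ∀ m, ℓl m = γ * σ2 * L / (2 * m) + c * m)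
    (ℓF : ℝ → ℝ) (hℓF : ∀ m, ℓF m = γ * σ2 * L / (2 * (m + M)) + c * m) :
    ℓF 0 = γ * σ2 * L / (2 * M) ∧ ℓl mstar = Real.sqrt (2 * γ * σ2 * L * c) ∧
      ℓF 0 ≤ ℓl mstar := by
  have hpos : 0 < mstar := hmstar ▸ Real.sqrt_pos.2 (by positivity)
  have hsq : γ * σ2 * L = 2 * c * mstar ^ 2 := by
    rw [hmstar, Real.sq_sqrt (by positivity)]
    field_simp
  have hF : ℓF 0 = γ * σ2 * L / (2 * M) := by simp [hℓF]
  refine ⟨hF, ?_, ?_⟩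
  · have hroot : 2 * γ * σ2 * L * c = (2 * c * mstar) ^ 2 := by
      linear_combination 2 * c * hsq
    rw [hℓl, hroot, Real.sqrt_sq (by positivity), hsq]
    field_simp
    ring
  · rw [hF, hℓl]
    calc γ * σ2 * L / (2 * M) ≤ γ * σ2 * L / (2 * mstar) := by gcongr
      _ ≤ γ * σ2 * L / (2 * mstar) + c * mstar := le_add_of_nonneg_right (by positivity)
end

section
/- Let γ, σ², L, c, λ be positive real numbers, let M ≥ 0, let m* = √(γσ²L/(2c)), and define ℓ_PFL(m) = γσ²L/(2(m + M)) + c·m + λ·(c/(2λ) − γσ²L/(4λ(m* + M)²) + m* − m)² for m > 0. Then the derivative of ℓ_PFL vanishes at m*, i.e., ℓ_PFL has derivative 0 at the point m = m*. -/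
/-- The derivative of the penalized federated loss
`ℓ_PFL(m) = γσ²L/(2(m + M)) + c·m + λ(c/(2λ) − γσ²L/(4λ(m* + M)²) + m* − m)²`
vanishes at `m* = √(γσ²L/(2c))`. -/
theorem pfl_deriv_zero_at_mstar
    (γ σ2 L c lam M : ℝ) (hγ : 0 < γ) (hσ : 0 < σ2) (hL : 0 < L) (hc : 0 < c)
    (hlam : 0 < lam) (hM : 0 ≤ M)
    (mstar : ℝ) (hmstar : mstar = Real.sqrt (γ * σ2 * L / (2 * c)))
    (ℓPFL : ℝ → ℝ)
    (hℓPFL : ∀ m, ℓPFL m = γ * σ2 * L / (2 * (m + M)) + c * m +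
      lam * (c / (2 * lam) - γ * σ2 * L / (4 * lam * (mstar + M) ^ 2) + mstar - m) ^ 2) :
    HasDerivAt ℓPFL 0 mstar := by
  have hpos : 0 < mstar := by
    rw [hmstar]
    positivity
  have hs : mstar + M ≠ 0 := by positivity
  rw [funext hℓPFL]
  have hden : HasDerivAt (fun m : ℝ => 2 * (m + M)) (2 * 1) mstar :=
    ((hasDerivAt_id mstar).add_const M).const_mul 2
  have herr := (hasDerivAt_const mstar (γ * σ2 * L)).fun_div hden (by positivity)
  have hcost := (hasDerivAt_id' mstar).const_mul c
  have hpen := (((hasDerivAt_id' mstar).const_sub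
    (c / (2 * lam) - γ * σ2 * L / (4 * lam * (mstar + M) ^ 2) + mstar)).fun_pow 2).const_mul lam
  refine ((herr.fun_add hcost).fun_add hpen).congr_deriv ?_
  norm_num only [Nat.cast_ofNat, pow_one, add_sub_cancel_right]
  field_simp
  ring
end

section
/- Let γ, σ², L, c, λ be positive real numbers, let M ≥ 0, let m* = √(γσ²L/(2c)), and define ℓ_PFL(m) = γσ²L/(2(m + M)) + c·m + λ·(c/(2λ) − γσ²L/(4λ(m* + M)²) + m* − m)² for m > 0. Then m* is the unique global minimizer of ℓ_PFL on (0, ∞): for every m > 0 with m ≠ m*, ℓ_PFL(m*) < ℓ_PFL(m). In particular the PFL optimum coincides with the locally optimal data usage, eliminating free riding. -/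
/-- Theorem (PFL Eliminates Free Riding): the penalized federated loss
`ℓ_PFL(m) = γσ²L/(2(m + M)) + c·m + λ(c/(2λ) − γσ²L/(4λ(m* + M)²) + m* − m)²`
is uniquely minimized on `(0, ∞)` at the locally optimal data amount
`m* = √(γσ²L/(2c))`. -/
theorem pfl_eliminates_free_riding
    (γ σ2 L c lam M : ℝ) (hγ : 0 < γ) (hσ : 0 < σ2) (hL : 0 < L) (hc : 0 < c)
    (hlam : 0 < lam) (hM : 0 ≤ M)
    (mstar : ℝ) (hmstar : mstar = Real.sqrt (γ * σ2 * L / (2 * c)))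
    (ℓPFL : ℝ → ℝ)
    (hℓPFL : ∀ m, ℓPFL m = γ * σ2 * L / (2 * (m + M)) + c * m +
      lam * (c / (2 * lam) - γ * σ2 * L / (4 * lam * (mstar + M) ^ 2) + mstar - m) ^ 2) :
    ∀ m : ℝ, 0 < m → m ≠ mstar → ℓPFL mstar < ℓPFL m := by
  intro m hm hne
  have hs : 0 < mstar := hmstar ▸ Real.sqrt_pos.mpr (by positivity)
  have hsM : 0 < mstar + M := by linarith
  have hmM : 0 < m + M := by linarith
  have hd : 0 < (m - mstar) ^ 2 := by
    have := sub_ne_zero.mpr hne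
    positivity
  have key : ℓPFL m - ℓPFL mstar =
      γ * σ2 * L * (m - mstar) ^ 2 / (2 * (mstar + M) ^ 2 * (m + M)) +
        lam * (m - mstar) ^ 2 := by
    rw [hℓPFL, hℓPFL]
    field_simp
    ring
  have hpos : 0 < ℓPFL m - ℓPFL mstar := by
    rw [key]
    positivity
  linarith
end

section
/- Let γ, σ², L, c, λ be positive real numbers, let M > 0, let m* = √(γσ²L/(2c)), and define ℓ_l(m) = γσ²L/(2m) + c·m and ℓ_PFL(m) = γσ²L/(2(m + M)) + c·m + λ·(c/(2λ) − γσ²L/(4λ(m* + M)²) + m* − m)². Then ℓ_l(m*) − ℓ_PFL(m*) ≥ 0 if and only if λ ≥ (m*(m* + M)/(2γσ²L·M))·(c − γσ²L/(2(m* + M)²))². -/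
/-- Individual rationality of PFL at the optimum holds iff the penalty
harshness is large enough:
`ℓ_l(m*) − ℓ_PFL(m*) ≥ 0 ↔ λ ≥ (m*(m* + M)/(2γσ²L·M))(c − γσ²L/(2(m* + M)²))²`. -/
theorem pfl_ir_iff_lambda_large
    (γ σ2 L c lam M : ℝ) (hγ : 0 < γ) (hσ : 0 < σ2) (hL : 0 < L) (hc : 0 < c)
    (hlam : 0 < lam) (hM : 0 < M)
    (mstar : ℝ) (hmstar : mstar = Real.sqrt (γ * σ2 * L / (2 * c)))
    (ℓl : ℝ → ℝ) (hℓl : ∀ m, ℓl m = γ * σ2 * L / (2 * m) + c * m)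
    (ℓPFL : ℝ → ℝ)
    (hℓPFL : ∀ m, ℓPFL m = γ * σ2 * L / (2 * (m + M)) + c * m +
      lam * (c / (2 * lam) - γ * σ2 * L / (4 * lam * (mstar + M) ^ 2) + mstar - m) ^ 2) :
    0 ≤ ℓl mstar - ℓPFL mstar ↔
      mstar * (mstar + M) / (2 * (γ * σ2 * L) * M) *
        (c - γ * σ2 * L / (2 * (mstar + M) ^ 2)) ^ 2 ≤ lam := by
  have hA : 0 < γ * σ2 * L := by positivity
  have hm : 0 < mstar := hmstar ▸ Real.sqrt_pos.2 (by positivity)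
  rw [hℓl, hℓPFL]
  generalize γ * σ2 * L = A at *
  have hs : 0 < mstar + M := by positivity
  have gap_eq : A / (2 * mstar) + c * mstar - (A / (2 * (mstar + M)) + c * mstar +
      lam * (c / (2 * lam) - A / (4 * lam * (mstar + M) ^ 2) + mstar - mstar) ^ 2) =
      A * M / (2 * mstar * (mstar + M) * lam) *
        (lam - mstar * (mstar + M) / (2 * A * M) * (c - A / (2 * (mstar + M) ^ 2)) ^ 2) := by
    have hshift : c / (2 * lam) - A / (4 * lam * (mstar + M) ^ 2) + mstar - mstar =
        (c - A / (2 * (mstar + M) ^ 2)) / (2 * lam) := by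
      field_simp
      ring
    rw [hshift]
    generalize c - A / (2 * (mstar + M) ^ 2) = D
    field_simp
    ring
  rw [gap_eq, mul_nonneg_iff_of_pos_left (by positivity), sub_nonneg]
end

section
/- Let γ, σ², L, c be positive real numbers, let M > 0, let m* = √(γσ²L/(2c)), let α ∈ [0, 2), and set λ = (m*(M + m*)/((2 − α)·γσ²L·M))·(c − γσ²L/(2(M + m*)²))². Then λ > 0, and with ℓ_l(m) = γσ²L/(2m) + c·m and ℓ_PFL(m) = γσ²L/(2(m + M)) + c·m + λ·(c/(2λ) − γσ²L/(4λ(m* + M)²) + m* − m)², the loss gap at the optimum satisfies ℓ_l(m*) − ℓ_PFL(m*) = (α/4)·γσ²L·M/(m*(M + m*)) ≥ 0; in particular PFL is individually rational at the optimum. -/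
/-- Lemma (PFL Assurance of IR at Optimum): with
`λ = (m*(M + m*)/((2 − α)γσ²L·M))(c − γσ²L/(2(M + m*)²))²` for `α ∈ [0, 2)`,
we have `λ > 0` and the loss gap at the optimum is
`ℓ_l(m*) − ℓ_PFL(m*) = (α/4)·γσ²L·M/(m*(M + m*)) ≥ 0`. -/
theorem pfl_assurance_of_ir
    (γ σ2 L c M α : ℝ) (hγ : 0 < γ) (hσ : 0 < σ2) (hL : 0 < L) (hc : 0 < c)
    (hM : 0 < M) (hα0 : 0 ≤ α) (hα2 : α < 2)
    (mstar : ℝ) (hmstar : mstar = Real.sqrt (γ * σ2 * L / (2 * c)))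
    (lam : ℝ)
    (hlam : lam = mstar * (M + mstar) / ((2 - α) * (γ * σ2 * L) * M) *
      (c - γ * σ2 * L / (2 * (M + mstar) ^ 2)) ^ 2)
    (ℓl : ℝ → ℝ) (hℓl : ∀ m, ℓl m = γ * σ2 * L / (2 * m) + c * m)
    (ℓPFL : ℝ → ℝ)
    (hℓPFL : ∀ m, ℓPFL m = γ * σ2 * L / (2 * (m + M)) + c * m +
      lam * (c / (2 * lam) - γ * σ2 * L / (4 * lam * (mstar + M) ^ 2) + mstar - m) ^ 2) :
    0 < lam ∧
      ℓl mstar - ℓPFL mstar = α / 4 * (γ * σ2 * L * M / (mstar * (M + mstar))) ∧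
      0 ≤ ℓl mstar - ℓPFL mstar := by
  set K := γ * σ2 * L
  have hKpos : 0 < K := by positivity
  have hm : 0 < mstar := hmstar ▸ Real.sqrt_pos.2 (by positivity)
  have hsq : mstar ^ 2 = K / (2 * c) := hmstar ▸ Real.sq_sqrt (by positivity)
  have hα : 0 < 2 - α := by linarith
  have hD : 0 < c - K / (2 * (M + mstar) ^ 2) := by
    have hKm : K = 2 * c * mstar ^ 2 := by rw [hsq]; field_simp
    rw [sub_pos, div_lt_iff₀ (by positivity), hKm]
    nlinarith [mul_pos hc (mul_pos hM hM), mul_pos hc (mul_pos hM hm)]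
  set D := c - K / (2 * (M + mstar) ^ 2) with hDdef
  have hlam0 : 0 < lam := by rw [hlam]; positivity
  have hpen : lam * (c / (2 * lam) - K / (4 * lam * (mstar + M) ^ 2) + mstar - mstar) ^ 2
      = (2 - α) / 4 * (K * M / (mstar * (M + mstar))) := by
    have hres : c / (2 * lam) - K / (4 * lam * (mstar + M) ^ 2) + mstar - mstar
        = D / (2 * lam) := by
      rw [hDdef, add_comm mstar M]
      field_simp
      ring
    have hsquare : lam * (D / (2 * lam)) ^ 2 = D ^ 2 / (4 * lam) := by
      field_simp
      ring
    rw [hres, hsquare, hlam]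
    field_simp
  have hgap : ℓl mstar - ℓPFL mstar = α / 4 * (K * M / (mstar * (M + mstar))) := by
    rw [hℓl, hℓPFL, hpen, add_comm mstar M]
    field_simp
    ring
  exact ⟨hlam0, hgap, hgap ▸ by positivity⟩
end

section
/- Let γ, σ², L, c be positive real numbers, let M > 0, let m* = √(γσ²L/(2c)), let α ∈ [0, 2), and set λ = (m*(M + m*)/((2 − α)·γσ²L·M))·(c − γσ²L/(2(M + m*)²))². Define ℓ_l(m) = γσ²L/(2m) + c·m and ℓ_PFL(m) = γσ²L/(2(m + M)) + c·m + λ·(c/(2λ) − γσ²L/(4λ(m* + M)²) + m* − m)². Then for every m > 0, ℓ_PFL(m*) ≤ ℓ_PFL(m) and ℓ_PFL(m*) ≤ ℓ_l(m); i.e., with this choice of λ, PFL has its optimum at the locally optimal data amount (eliminating free riding) and never yields a worse loss than any local training strategy (individual rationality). -/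
/-- The convex function `x ↦ K / (2 * x)` lies above its tangent line at `y`. -/
lemma tangent_le_div_two_mul {K x y : ℝ} (hK : 0 ≤ K) (hx : 0 < x) (hy : 0 < y) :
    K / (2 * y) - K / (2 * y ^ 2) * (x - y) ≤ K / (2 * x) := by
  have h : K / (2 * x) - (K / (2 * y) - K / (2 * y ^ 2) * (x - y)) =
      K * (x - y) ^ 2 / (2 * x * y ^ 2) := by
    field_simp
    ring
  have : 0 ≤ K * (x - y) ^ 2 / (2 * x * y ^ 2) := by positivity
  linarith

/-- The local loss `m ↦ K / (2 * m) + c * m` is minimized at `s` when `K = 2 * c * s ^ 2`. -/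
lemma local_loss_min {K c s m : ℝ} (hc : 0 ≤ c) (hs : 0 < s) (hm : 0 < m)
    (hK : K = 2 * c * s ^ 2) : K / (2 * s) + c * s ≤ K / (2 * m) + c * m := by
  have h := tangent_le_div_two_mul (K := K) (by rw [hK]; positivity) hm hs
  have hslope : K / (2 * s ^ 2) = c := by
    rw [hK]
    field_simp
  rw [hslope] at h
  linarith

/-- Expansion of the free-riding penalty around its reference point `s`. -/
lemma penalty_expand {lam K c M s : ℝ} (hlam : lam ≠ 0) (hsM : s + M ≠ 0) (m : ℝ) :
    lam * (c / (2 * lam) - K / (4 * lam * (s + M) ^ 2) + s - m) ^ 2 =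
      (c - K / (2 * (s + M) ^ 2)) ^ 2 / (4 * lam) +
        (c - K / (2 * (s + M) ^ 2)) * (s - m) + lam * (s - m) ^ 2 := by
  field_simp
  ring

/-- Theorem (Elimination of Federated Free-Riding With Truthful Agents): with
the IR choice of `λ`, the PFL optimum is at the locally optimal data amount
(`ℓ_PFL(m*) ≤ ℓ_PFL(m)` for all `m > 0`, eliminating free riding) and PFL never
yields a worse loss than any local training strategy
(`ℓ_PFL(m*) ≤ ℓ_l(m)` for all `m > 0`, individual rationality). -/
theorem pfl_eliminates_free_riding_and_is_ir
    (γ σ2 L c M α : ℝ) (hγ : 0 < γ) (hσ : 0 < σ2) (hL : 0 < L) (hc : 0 < c)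
    (hM : 0 < M) (hα0 : 0 ≤ α) (hα2 : α < 2)
    (mstar : ℝ) (hmstar : mstar = Real.sqrt (γ * σ2 * L / (2 * c)))
    (lam : ℝ)
    (hlam : lam = mstar * (M + mstar) / ((2 - α) * (γ * σ2 * L) * M) *
      (c - γ * σ2 * L / (2 * (M + mstar) ^ 2)) ^ 2)
    (ℓl : ℝ → ℝ) (hℓl : ∀ m, ℓl m = γ * σ2 * L / (2 * m) + c * m)
    (ℓPFL : ℝ → ℝ)
    (hℓPFL : ∀ m, ℓPFL m = γ * σ2 * L / (2 * (m + M)) + c * m +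
      lam * (c / (2 * lam) - γ * σ2 * L / (4 * lam * (mstar + M) ^ 2) + mstar - m) ^ 2) :
    ∀ m : ℝ, 0 < m → ℓPFL mstar ≤ ℓPFL m ∧ ℓPFL mstar ≤ ℓl m := by
  intro m hm
  have hK : 0 < γ * σ2 * L := by positivity
  generalize γ * σ2 * L = K at *
  have hs : 0 < mstar := by rw [hmstar]; positivity
  have hKs : K = 2 * c * mstar ^ 2 := by
    rw [hmstar, Real.sq_sqrt (by positivity)]
    field_simp
  have hsM : 0 < mstar + M := by positivity
  have hα : 0 < 2 - α := by linarith
  rw [add_comm M mstar] at hlam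
  have hexp := penalty_expand (lam := lam) (K := K) (c := c) (M := M) (s := mstar)
  have hD : 0 < c - K / (2 * (mstar + M) ^ 2) := by
    rw [sub_pos, div_lt_iff₀ (by positivity), hKs]
    have : 0 < c * (M * (2 * mstar + M)) := by positivity
    nlinarith
  have hD_eq : c - (c - K / (2 * (mstar + M) ^ 2)) = K / (2 * (mstar + M) ^ 2) := by ring
  generalize c - K / (2 * (mstar + M) ^ 2) = D at *
  have hlam0 : 0 < lam := by rw [hlam]; positivity
  have hstar : ℓPFL mstar = K / (2 * (mstar + M)) + c * mstar + D ^ 2 / (4 * lam) := by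
    rw [hℓPFL, hexp hlam0.ne' hsM.ne']
    ring
  constructor
  · have htan := tangent_le_div_two_mul hK.le (add_pos hm hM) hsM
    have hsq : 0 ≤ lam * (mstar - m) ^ 2 := by positivity
    rw [hstar, hℓPFL, hexp hlam0.ne' hsM.ne']
    rw [← hD_eq] at htan
    linarith
  · have hpen : D ^ 2 / (4 * lam) =
        K / (2 * mstar) - K / (2 * (mstar + M)) - α * K * M / (4 * mstar * (mstar + M)) := by
      rw [hlam]
      field_simp
      ring
    have hgap : 0 ≤ α * K * M / (4 * mstar * (mstar + M)) := by positivity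
    have hloc := local_loss_min hc.le hs hm hKs
    rw [hstar, hℓl]
    linarith
end

section
/- Let γ, σ², L be positive real numbers, let c_i > 0 be an agent's true cost, let k ≥ 0, and let F : ℝ → ℝ satisfy 0 ≤ F(c) ≤ 1 for all c and F(c_i) = 1/2. Define the expected FACT loss g(m, c) = γσ²L/(2m) + c_i·m − k·2·F(c)·(1 − F(c)) for m > 0 and c ∈ ℝ, and let m* = √(γσ²L/(2c_i)). Then (m*, c_i) is a global minimizer of g: for every m > 0 and every c ∈ ℝ, g(m*, c_i) ≤ g(m, c). -/
/-- Main Theorem (FACT optimality): the expected FACT loss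
`g(m, c) = γσ²L/(2m) + c_i·m − k·2F(c)(1 − F(c))`, where `F` is the agent-cost
CDF (valued in `[0,1]`) with `F(c_i) = 1/2` and `k ≥ 0`, is globally minimized
at reporting the true cost and using the locally optimal data amount
`(m*, c_i) = (√(γσ²L/(2c_i)), c_i)`. -/
theorem fact_best_strategy_truthful
    (γ σ2 L ci k : ℝ) (hγ : 0 < γ) (hσ : 0 < σ2) (hL : 0 < L) (hci : 0 < ci)
    (hk : 0 ≤ k)
    (F : ℝ → ℝ) (hF0 : ∀ x, 0 ≤ F x) (hF1 : ∀ x, F x ≤ 1)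
    (hFci : F ci = 1 / 2)
    (g : ℝ → ℝ → ℝ)
    (hg : ∀ m x, g m x = γ * σ2 * L / (2 * m) + ci * m - k * (2 * F x * (1 - F x)))
    (mstar : ℝ) (hmstar : mstar = Real.sqrt (γ * σ2 * L / (2 * ci))) :
    ∀ m : ℝ, 0 < m → ∀ x : ℝ, g mstar ci ≤ g m x := by
  intro m hm x
  have hs : 0 < mstar := by rw [hmstar]; positivity
  have hA : γ * σ2 * L = 2 * ci * mstar ^ 2 := by
    rw [hmstar, Real.sq_sqrt (by positivity)]
    field_simp
  have hwin : k * (2 * F x * (1 - F x)) ≤ k * (1 / 2) :=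
    mul_le_mul_of_nonneg_left (by nlinarith [sq_nonneg (2 * F x - 1)]) hk
  have hopt : 2 * ci * mstar ^ 2 / (2 * mstar) = ci * mstar := by field_simp
  have hgap : 2 * ci * mstar ^ 2 / (2 * m) + ci * m - 2 * (ci * mstar)
      = ci * (mstar - m) ^ 2 / m := by
    field_simp
    ring
  have hgap_nonneg : 0 ≤ ci * (mstar - m) ^ 2 / m := by positivity
  rw [hg, hg, hFci, hA, hopt]
  linarith
end
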